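/- For every q ∈ (1, ∞) and every γ ∈ (−1, q] there exists a constant C > 0 (depending only on q and γ) such that: for every n ≥ 1, every σ = (λ_1, …, λ_n) ∈ D^n with r = max_i |λ_i|, and every z ∈ ℂ with |z| ≤ 1, the second derivative of the reproducing kernel k_z^B (B = B_σ) satisfies ‖(k_z^B)''‖_{A^q(γ)} ≤ C · (n/(1−r))^{3−(γ+2)/q}. (Proposition 4.1, part (4).) -/

import Mathlib

open Complex Metric

noncomputable section

/-- The elementary Blaschke factor `b_λ(z) = (λ - z)/(1 - conj(λ) z)`. -/
def blaschkeF (l z : ℂ) : ℂ := (l - z) / (1 - (starRingEnd ℂ) l * z)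

/-- The finite Blaschke product `B_σ = ∏ b_{λ_i}`. -/
def blaschkeProd {n : ℕ} (σ : Fin n → ℂ) (z : ℂ) : ℂ := ∏ i, blaschkeF (σ i) z

/-- The reproducing kernel of the model space `K_{B_σ}`:
`k_z^B(w) = (1 - conj(B(z)) B(w))/(1 - conj(z) w)`. -/
def modelKernel {n : ℕ} (σ : Fin n → ℂ) (z w : ℂ) : ℂ :=
  (1 - (starRingEnd ℂ) (blaschkeProd σ z) * blaschkeProd σ w) /
    (1 - (starRingEnd ℂ) z * w)

/-- The radial-weighted Bergman norm
`‖f‖_{A^q(γ)} = (∫_D |f|^q (1-|z|^2)^γ dA)^{1/q}`, `dA` normalized area measure. -/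
def bergmanNorm (q γ : ℝ) (f : ℂ → ℂ) : ℝ :=
  (Real.pi⁻¹ * ∫ z in ball (0:ℂ) 1, ‖f z‖ ^ q * (1 - ‖z‖ ^ 2) ^ γ) ^ (1 / q)

open MeasureTheory Set

theorem norm_conj_mul_le_norm {z w : ℂ} (hz : ‖z‖ ≤ 1) : ‖(starRingEnd ℂ) z * w‖ ≤ ‖w‖ := by
  rw [norm_mul, RCLike.norm_conj]
  exact mul_le_of_le_one_left (norm_nonneg _) hz

theorem one_sub_norm_le_norm_one_sub_conj_mul {z w : ℂ} (hz : ‖z‖ ≤ 1) :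
    1 - ‖w‖ ≤ ‖1 - (starRingEnd ℂ) z * w‖ := by
  have h1 := norm_sub_norm_le 1 ((starRingEnd ℂ) z * w)
  have h2 := norm_conj_mul_le_norm (w := w) hz
  rw [norm_one] at h1
  linarith

/-- The identity `|l - w|² - |1 - conj(l) w|² = -(1 - |l|²)(1 - |w|²)`. -/
theorem norm_sub_sq_eq (l w : ℂ) :
    ‖l - w‖ ^ 2 = ‖1 - (starRingEnd ℂ) l * w‖ ^ 2 + (1 - ‖l‖ ^ 2) * (‖w‖ ^ 2 - 1) := by
  simp only [Complex.sq_norm, Complex.normSq_apply]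
  simp
  ring

theorem norm_blaschkeF_le_one {l w : ℂ} (hl : ‖l‖ < 1) (hw : ‖w‖ ≤ 1) :
    ‖blaschkeF l w‖ ≤ 1 := by
  rw [blaschkeF, norm_div]
  refine div_le_one_of_le₀ ?_ (norm_nonneg _)
  rw [← abs_norm (l - w), ← abs_norm (1 - _), ← sq_le_sq, norm_sub_sq_eq]
  have h1 : 0 ≤ 1 - ‖l‖ ^ 2 := by nlinarith [norm_nonneg l]
  have h2 : 0 ≤ 1 - ‖w‖ ^ 2 := by nlinarith [norm_nonneg w]
  nlinarith [mul_nonneg h1 h2]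

theorem norm_blaschkeProd_le_pow {n : ℕ} {σ : Fin n → ℂ} {w : ℂ} {β : ℝ}
    (h : ∀ i, ‖blaschkeF (σ i) w‖ ≤ β) : ‖blaschkeProd σ w‖ ≤ β ^ n := by
  rw [blaschkeProd, norm_prod]
  simpa using Finset.prod_le_prod (s := Finset.univ) (fun i _ => norm_nonneg _) (fun i _ => h i)

/-- Distance from the poles on a slightly larger disc. -/
theorem half_le_norm_one_sub_conj_mul {l w : ℂ} {ε : ℝ} (hε : 0 ≤ ε)
    (hl : ε ≤ 1 - ‖l‖) (hw : ‖w‖ ≤ 1 + ε / 2) :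
    (1 - ‖l‖) / 2 ≤ ‖1 - (starRingEnd ℂ) l * w‖ := by
  have h1 := norm_sub_norm_le 1 ((starRingEnd ℂ) l * w)
  rw [norm_one, norm_mul, RCLike.norm_conj] at h1
  nlinarith [norm_nonneg l, mul_le_mul_of_nonneg_left hw (norm_nonneg l)]

/-- Growth of a Blaschke factor on a slightly larger disc. -/
theorem norm_blaschkeF_le_one_add {l w : ℂ} {ε η : ℝ} (hε : 0 < ε) (hη : η ≤ 1)
    (hl : ε ≤ η * (1 - ‖l‖)) (hl1 : ‖l‖ < 1) (hw : ‖w‖ ≤ 1 + ε / 2) :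
    ‖blaschkeF l w‖ ≤ 1 + 10 * η := by
  have hη0 : 0 < η := by
    by_contra! h
    nlinarith
  have hlε : ε ≤ 1 - ‖l‖ := hl.trans (by nlinarith)
  have hd := half_le_norm_one_sub_conj_mul hε.le hlε hw
  have hl0 := norm_nonneg l
  have hd0 : 0 < ‖1 - (starRingEnd ℂ) l * w‖ := by linarith
  rw [blaschkeF, norm_div, div_le_iff₀ hd0]
  refine le_of_sq_le_sq ?_ (by positivity)
  rw [norm_sub_sq_eq, mul_pow]
  set D := ‖1 - (starRingEnd ℂ) l * w‖
  set a := 1 - ‖l‖ with ha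
  have ha0 : 0 < a := by simp only [ha]; linarith
  have ha1 : a ≤ 1 := by simp only [ha]; linarith
  have hDsq : a ^ 2 / 4 ≤ D ^ 2 := by nlinarith
  have h1 : 1 - ‖l‖ ^ 2 ≤ 2 * a := by simp only [ha]; nlinarith
  have h1' : 0 ≤ 1 - ‖l‖ ^ 2 := by nlinarith
  have h2 : ‖w‖ ^ 2 - 1 ≤ 5 / 4 * ε := by nlinarith [norm_nonneg w]
  have h3 : (1 - ‖l‖ ^ 2) * (‖w‖ ^ 2 - 1) ≤ (1 - ‖l‖ ^ 2) * (5 / 4 * ε) :=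
    mul_le_mul_of_nonneg_left h2 h1'
  have h4 : (1 - ‖l‖ ^ 2) * (5 / 4 * ε) ≤ 2 * a * (5 / 4 * ε) :=
    mul_le_mul_of_nonneg_right h1 (by positivity)
  have h5 : 2 * a * (5 / 4 * ε) ≤ 2 * a * (5 / 4 * (η * a)) := by gcongr
  have h6 : 10 * η * (a ^ 2 / 4) ≤ 10 * η * D ^ 2 := by gcongr
  nlinarith [mul_pos hη0 hη0, sq_nonneg D, mul_nonneg (mul_pos hη0 hη0).le (sq_nonneg D),
    mul_nonneg hη0.le (sq_nonneg D)]

/-- A holomorphic continuation of the model kernel across the unit circle, obtained from the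
Takenaka–Malmquist expansion. -/
theorem exists_modelKernel_continuation {U : Set ℂ} {s β : ℝ} (hs : 0 < s) (hβ : 1 ≤ β)
    {z : ℂ} (hz : ‖z‖ ≤ 1) (n : ℕ) (σ : Fin n → ℂ) (hσ : ∀ i, ‖σ i‖ < 1)
    (hsU : ∀ w ∈ U, ∀ i, s ≤ ‖1 - (starRingEnd ℂ) (σ i) * w‖)
    (hβU : ∀ w ∈ U, ∀ i, ‖blaschkeF (σ i) w‖ ≤ β) :
    ∃ F : ℂ → ℂ, DifferentiableOn ℂ F U ∧
      (∀ w ∈ U, F w * (1 - (starRingEnd ℂ) z * w) =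
        1 - (starRingEnd ℂ) (blaschkeProd σ z) * blaschkeProd σ w) ∧
      ∀ w ∈ U, ‖F w‖ ≤ n * β ^ n * (2 / s) := by
  induction n with
  | zero => exact ⟨fun _ => 0, by fun_prop, by simp [blaschkeProd], by simp⟩
  | succ n ih =>
    obtain ⟨F, hF, hFe, hFb⟩ := ih (fun i => σ i.succ) (fun i => hσ _)
      (fun w hw i => hsU w hw _) (fun w hw i => hβU w hw _)
    set l := σ 0 with hl
    have hl1 : ‖l‖ < 1 := hσ 0
    have hl0 := norm_nonneg l
    have hzl : 1 - ‖l‖ ≤ ‖1 - l * (starRingEnd ℂ) z‖ := by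
      have := norm_sub_norm_le 1 (l * (starRingEnd ℂ) z)
      rw [norm_one, norm_mul, RCLike.norm_conj] at this
      nlinarith
    have hzl0 : 1 - l * (starRingEnd ℂ) z ≠ 0 := norm_pos_iff.1 (by linarith)
    have hne : ∀ w ∈ U, 1 - (starRingEnd ℂ) l * w ≠ 0 := fun w hw =>
      norm_pos_iff.1 (hs.trans_le (hsU w hw 0))
    refine ⟨fun w => (1 - (‖l‖ : ℂ) ^ 2) / ((1 - (starRingEnd ℂ) l * w) *
        (1 - l * (starRingEnd ℂ) z)) +
        (starRingEnd ℂ) (blaschkeF l z) * blaschkeF l w * F w, ?_, ?_, ?_⟩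
    · refine DifferentiableOn.add (DifferentiableOn.div (by fun_prop) (by fun_prop)
        fun w hw => mul_ne_zero (hne w hw) hzl0) (DifferentiableOn.mul ?_ hF)
      exact DifferentiableOn.mul (by fun_prop)
        (DifferentiableOn.div (by fun_prop) (by fun_prop) hne)
    · intro w hw
      have h1 := hne w hw
      have h2 := hFe w hw
      have hp (v : ℂ) : blaschkeProd σ v =
          blaschkeF l v * blaschkeProd (fun i => σ i.succ) v := by
        simp [blaschkeProd, Fin.prod_univ_succ, hl]
      have h3 : (1 - (‖l‖ : ℂ) ^ 2) / ((1 - (starRingEnd ℂ) l * w) *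
          (1 - l * (starRingEnd ℂ) z)) * (1 - (starRingEnd ℂ) z * w) =
          1 - (starRingEnd ℂ) (blaschkeF l z) * blaschkeF l w := by
        rw [← Complex.mul_conj' l]
        simp only [blaschkeF, map_div₀, map_sub, map_mul, map_one, Complex.conj_conj]
        field_simp
        ring
      simp only [hp, map_mul]
      linear_combination h3 + (starRingEnd ℂ) (blaschkeF l z) * blaschkeF l w * h2
    · intro w hw
      have h1 := hsU w hw 0
      have hb1 := hβU w hw 0
      have hb2 : ‖blaschkeF l z‖ ≤ 1 := norm_blaschkeF_le_one hl1 hz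
      have h3 : ‖(1 - (‖l‖ : ℂ) ^ 2) / ((1 - (starRingEnd ℂ) l * w) *
          (1 - l * (starRingEnd ℂ) z))‖ ≤ 2 / s := by
        have h4 : ‖(1 - (‖l‖ : ℂ) ^ 2)‖ = 1 - ‖l‖ ^ 2 := by
          rw [show (1 - (‖l‖ : ℂ) ^ 2) = ((1 - ‖l‖ ^ 2 : ℝ) : ℂ) by push_cast; rfl,
            Complex.norm_real, Real.norm_of_nonneg (by nlinarith)]
        rw [norm_div, norm_mul, h4, div_le_div_iff₀
          (mul_pos (hs.trans_le h1) (norm_pos_iff.2 hzl0)) hs]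
        have h5 : s * (1 - ‖l‖) ≤ ‖1 - (starRingEnd ℂ) l * w‖ * ‖1 - l * (starRingEnd ℂ) z‖ :=
          mul_le_mul h1 hzl (by linarith) (norm_nonneg _)
        nlinarith [mul_nonneg hs.le (by linarith : 0 ≤ 1 - ‖l‖)]
      have h6 : ‖(starRingEnd ℂ) (blaschkeF l z) * blaschkeF l w * F w‖ ≤
          1 * β * (n * β ^ n * (2 / s)) := by
        rw [norm_mul, norm_mul, RCLike.norm_conj]
        have := hFb w hw
        gcongr
      refine (norm_add_le _ _).trans ((add_le_add h3 h6).trans ?_)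
      have h7 : 1 * (2 / s) ≤ β ^ (n + 1) * (2 / s) := by
        gcongr
        exact one_le_pow₀ hβ
      push_cast
      rw [pow_succ] at *
      linarith

theorem exists_pointwise_bound :
    ∃ A : ℝ, 0 < A ∧ ∀ (n : ℕ), 1 ≤ n → ∀ σ : Fin n → ℂ, ∀ r : ℝ, (∀ i, ‖σ i‖ ≤ r) → r < 1 →
      ∀ z : ℂ, ‖z‖ ≤ 1 → ∀ w : ℂ, ‖w‖ < 1 →
        ‖iteratedDeriv 2 (modelKernel σ z) w‖ ≤
          A / (((1 - r) / n + (1 - ‖w‖)) ^ 2 *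
            ((1 - r) / n + ‖1 - (starRingEnd ℂ) z * w‖)) := by
  refine ⟨256 * Real.exp 10, by positivity, fun n hn σ r hr hr1 z hz w hw => ?_⟩
  have hn' : (1 : ℝ) ≤ n := by exact_mod_cast hn
  have hr0 : 0 ≤ r := (norm_nonneg _).trans (hr ⟨0, hn⟩)
  set ε := (1 - r) / n with hε
  have hε0 : 0 < ε := div_pos (by linarith) (by linarith)
  have hε1 : ε ≤ 1 - r := div_le_self (by linarith) hn'
  set U : Set ℂ := {v | ‖v‖ ≤ 1 + ε / 2}
  have hσ : ∀ i, ‖σ i‖ < 1 := fun i => (hr i).trans_lt hr1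
  set β : ℝ := 1 + 10 * (1 / n)
  have hβ1 : 1 ≤ β := by simp only [β]; linarith [show (0 : ℝ) ≤ 1 / n by positivity]
  have hβn : β ^ n ≤ Real.exp 10 := by
    have h1 : β ≤ Real.exp (10 * (1 / n)) := by
      simp only [β]; linarith [Real.add_one_le_exp (10 * (1 / (n : ℝ)))]
    calc β ^ n ≤ Real.exp (10 * (1 / n)) ^ n := by gcongr
      _ = Real.exp 10 := by
        rw [← Real.exp_nat_mul]
        congr 1
        field_simp
  have hβU : ∀ v ∈ U, ∀ i, ‖blaschkeF (σ i) v‖ ≤ β := by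
    intro v hv i
    refine norm_blaschkeF_le_one_add hε0 (div_le_one_of_le₀ hn' (by linarith)) ?_ (hσ i) hv
    rw [hε, div_eq_mul_one_div, mul_comm]
    gcongr
    exact hr i
  obtain ⟨F, hF, hFe, hFb⟩ := exists_modelKernel_continuation (U := U) (s := (1 - r) / 2)
    (by linarith) hβ1 hz n σ hσ
    (fun v hv i => le_trans (by linarith [hr i])
      (half_le_norm_one_sub_conj_mul hε0.le (by linarith [hr i]) hv)) hβU
  have hE1 : 1 ≤ Real.exp 10 := Real.one_le_exp (by norm_num)
  have hFbound : ∀ v ∈ U, ‖F v‖ * (ε + ‖1 - (starRingEnd ℂ) z * v‖) ≤ 6 * Real.exp 10 := by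
    intro v hv
    have h1 : ‖F v‖ * ε ≤ 4 * Real.exp 10 := by
      calc ‖F v‖ * ε ≤ (n * β ^ n * (2 / ((1 - r) / 2))) * ε := by gcongr; exact hFb v hv
        _ = 4 * β ^ n := by
          have : (1 - r) ≠ 0 := by linarith
          rw [hε]; field_simp; ring
        _ ≤ _ := by gcongr
    have h2 : ‖F v‖ * ‖1 - (starRingEnd ℂ) z * v‖ ≤ 1 + Real.exp 10 := by
      rw [← norm_mul, hFe v hv]
      refine (norm_sub_le _ _).trans ?_
      rw [norm_one, norm_mul, RCLike.norm_conj]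
      have h3 : ‖blaschkeProd σ z‖ ≤ 1 := by
        simpa using norm_blaschkeProd_le_pow fun i => norm_blaschkeF_le_one (hσ i) hz
      have h4 := (norm_blaschkeProd_le_pow (hβU v hv)).trans hβn
      nlinarith [norm_nonneg (blaschkeProd σ z), norm_nonneg (blaschkeProd σ v)]
    linarith
  set d := ‖1 - (starRingEnd ℂ) z * w‖ with hd
  have hδd : 1 - ‖w‖ ≤ d := one_sub_norm_le_norm_one_sub_conj_mul hz
  have hρ0 : 0 < (ε + (1 - ‖w‖)) / 4 := by linarith
  have hsub : closedBall w ((ε + (1 - ‖w‖)) / 4) ⊆ U := by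
    intro v hv
    rw [mem_closedBall, dist_eq_norm] at hv
    change ‖v‖ ≤ 1 + ε / 2
    have := norm_le_norm_add_norm_sub' v w
    linarith
  have heq : modelKernel σ z =ᶠ[nhds w] F := by
    filter_upwards [isOpen_ball.mem_nhds (show w ∈ ball (0 : ℂ) 1 by simpa using hw)] with v hv
    have hv1 : ‖v‖ < 1 := by simpa using hv
    have h1 : 0 < ‖1 - (starRingEnd ℂ) z * v‖ :=
      lt_of_lt_of_le (by linarith) (one_sub_norm_le_norm_one_sub_conj_mul hz)
    rw [modelKernel, div_eq_iff (norm_pos_iff.1 h1)]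
    exact (hFe v (show ‖v‖ ≤ 1 + ε / 2 by linarith)).symm
  rw [heq.iteratedDeriv_eq 2]
  have hdiff : DiffContOnCl ℂ F (ball w ((ε + (1 - ‖w‖)) / 4)) := by
    refine DifferentiableOn.diffContOnCl ?_
    rw [closure_ball _ hρ0.ne']
    exact hF.mono hsub
  have hsph : ∀ v ∈ sphere w ((ε + (1 - ‖w‖)) / 4), ‖F v‖ ≤ 8 * Real.exp 10 / (ε + d) := by
    intro v hv
    have h1 := hFbound v (hsub (sphere_subset_closedBall hv))
    rw [mem_sphere, dist_eq_norm] at hv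
    have h2 : d ≤ ‖1 - (starRingEnd ℂ) z * v‖ + (ε + (1 - ‖w‖)) / 4 := by
      have h3 : 1 - (starRingEnd ℂ) z * w =
          (1 - (starRingEnd ℂ) z * v) + (starRingEnd ℂ) z * (v - w) := by ring
      rw [hd, h3]
      refine (norm_add_le _ _).trans ?_
      gcongr
      exact (norm_conj_mul_le_norm hz).trans hv.le
    rw [le_div_iff₀ (by linarith)]
    have h4 : ‖F v‖ * (3 / 4 * (ε + d)) ≤ ‖F v‖ * (ε + ‖1 - (starRingEnd ℂ) z * v‖) := by
      gcongr
      linarith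
    linarith
  refine (Complex.norm_iteratedDeriv_le_of_forall_mem_sphere_norm_le 2 hρ0 hdiff hsph).trans
    (le_of_eq ?_)
  have h1 : ε + (1 - ‖w‖) ≠ 0 := by linarith
  have h2 : ε + d ≠ 0 := by linarith
  simp only [Nat.factorial]
  push_cast
  field_simp
  norm_num

theorem abs_le_four_mul_norm_one_sub {ρ θ : ℝ} (hρ0 : 0 ≤ ρ) (hθ : |θ| ≤ Real.pi) :
    |θ| ≤ 4 * ‖1 - (ρ : ℂ) * (Real.cos θ + Real.sin θ * Complex.I)‖ := by
  refine le_of_sq_le_sq ?_ (by positivity)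
  rw [mul_pow, Complex.sq_norm, Complex.normSq_apply, sq_abs]
  have hcos := Real.cos_le_one_sub_mul_cos_sq hθ
  have hpi := Real.pi_pos
  set x := θ ^ 2 / Real.pi ^ 2 with hx
  have hθx : θ ^ 2 = Real.pi ^ 2 * x := by rw [hx]; field_simp
  have hx0 : 0 ≤ x := by positivity
  have hx1 : x ≤ 1 := by
    refine div_le_one_of_le₀ ?_ (by positivity)
    rw [← sq_abs θ]
    gcongr
  have hcos' : Real.cos θ ≤ 1 - 2 * x := by
    refine hcos.trans (le_of_eq ?_)
    rw [hx]; ring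
  have hpi4 : Real.pi ^ 2 ≤ 16 := by nlinarith [Real.pi_le_four]
  have hnorm : (1 - (ρ : ℂ) * (Real.cos θ + Real.sin θ * Complex.I)).re *
      (1 - (ρ : ℂ) * (Real.cos θ + Real.sin θ * Complex.I)).re +
      (1 - (ρ : ℂ) * (Real.cos θ + Real.sin θ * Complex.I)).im *
      (1 - (ρ : ℂ) * (Real.cos θ + Real.sin θ * Complex.I)).im =
      1 - 2 * ρ * Real.cos θ + ρ ^ 2 := by
    simp [-Complex.ofReal_cos, -Complex.ofReal_sin]
    linear_combination ρ ^ 2 * Real.sin_sq_add_cos_sq θ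
  rw [hnorm, hθx]
  have h1 : x ≤ 1 - 2 * ρ * Real.cos θ + ρ ^ 2 := by
    nlinarith [mul_le_mul_of_nonneg_left hcos' hρ0, mul_nonneg hρ0 hx0,
      mul_nonneg (sub_nonneg.2 hx1) (sq_nonneg (1 - ρ)), mul_nonneg hx0 (sq_nonneg ρ)]
  nlinarith

theorem integrableOn_one_add_rpow_mul_rpow {a γ : ℝ} (hγ : -1 < γ) (ha : γ + 1 < a) :
    IntegrableOn (fun u : ℝ => (1 + u) ^ (-a) * u ^ γ) (Ioi 0) := by
  have hmeas : ∀ s : Set ℝ, AEStronglyMeasurable (fun u : ℝ => (1 + u) ^ (-a) * u ^ γ)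
      (volume.restrict s) := fun s => Measurable.aestronglyMeasurable (by fun_prop)
  rw [← Ioc_union_Ioi_eq_Ioi zero_le_one]
  refine IntegrableOn.union ?_ ?_
  · have h := (intervalIntegrable_iff_integrableOn_Ioc_of_le zero_le_one).1
      (intervalIntegral.intervalIntegrable_rpow' (a := 0) (b := 1) hγ)
    refine Integrable.mono' h (hmeas _) (ae_restrict_of_forall_mem measurableSet_Ioc ?_)
    intro u hu
    have hu0 : 0 < u := hu.1
    rw [Real.norm_of_nonneg (by positivity)]
    refine mul_le_of_le_one_left (by positivity) ?_
    exact Real.rpow_le_one_of_one_le_of_nonpos (by linarith) (by linarith)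
  · have h := integrableOn_Ioi_rpow_of_lt (show γ - a < -1 by linarith) zero_lt_one
    refine Integrable.mono' h (hmeas _) (ae_restrict_of_forall_mem measurableSet_Ioi ?_)
    intro u hu
    have hu0 : 0 < u := zero_lt_one.trans hu
    rw [Real.norm_of_nonneg (by positivity), sub_eq_neg_add, Real.rpow_add hu0]
    refine mul_le_mul_of_nonneg_right ?_ (by positivity)
    exact Real.rpow_le_rpow_of_nonpos hu0 (by linarith) (by linarith)

/-- The radial majorant. -/
def radialMajorant (a γ ε : ℝ) : ℝ → ℝ :=
  (Ioi (0 : ℝ)).indicator fun t => (ε + t) ^ (-a) * t ^ γ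

theorem radialMajorant_nonneg {a γ ε : ℝ} (hε : 0 < ε) (t : ℝ) : 0 ≤ radialMajorant a γ ε t := by
  refine indicator_nonneg (fun t ht => ?_) t
  have : 0 < t := ht
  positivity

theorem radialMajorant_eq {a γ ε : ℝ} (hε : 0 < ε) (t : ℝ) :
    radialMajorant a γ ε t = ε ^ (γ - a) * radialMajorant a γ 1 (t / ε) := by
  by_cases ht : 0 < t
  · rw [radialMajorant, radialMajorant, indicator_of_mem (mem_Ioi.2 ht),
      indicator_of_mem (mem_Ioi.2 (div_pos ht hε)),
      show ε + t = ε * (1 + t / ε) by field_simp, Real.mul_rpow hε.le (by positivity),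
      Real.div_rpow ht.le hε.le, sub_eq_neg_add, Real.rpow_add hε]
    field_simp
  · rw [radialMajorant, radialMajorant, indicator_of_notMem (by simpa using ht),
      indicator_of_notMem, mul_zero]
    simpa using div_nonpos_of_nonpos_of_nonneg (not_lt.1 ht) hε.le

theorem integrable_radialMajorant {a γ ε : ℝ} (hγ : -1 < γ) (ha : γ + 1 < a) (hε : 0 < ε) :
    Integrable (radialMajorant a γ ε) := by
  have h1 : Integrable (radialMajorant a γ 1) :=
    (integrable_indicator_iff measurableSet_Ioi).2 (integrableOn_one_add_rpow_mul_rpow hγ ha)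
  rw [funext (radialMajorant_eq (a := a) (γ := γ) hε)]
  exact (h1.comp_div hε.ne').const_mul _

theorem integral_radialMajorant {a γ ε : ℝ} (hε : 0 < ε) :
    ∫ t, radialMajorant a γ ε t = ε ^ (γ - a + 1) * ∫ t, radialMajorant a γ 1 t := by
  rw [funext (radialMajorant_eq (a := a) (γ := γ) hε), integral_const_mul,
    Measure.integral_comp_div, abs_of_pos hε, Real.rpow_add_one hε.ne', smul_eq_mul, mul_assoc]

theorem add_abs_rpow_eq {a ε : ℝ} (hε : 0 < ε) (t : ℝ) :
    (ε + |t|) ^ (-a) = ε ^ (-a) * (1 + ‖t / ε‖) ^ (-a) := by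
  rw [← Real.mul_rpow hε.le (by positivity), norm_div, Real.norm_eq_abs, Real.norm_of_nonneg hε.le]
  congr 1
  field_simp

theorem integrable_add_abs_rpow {a ε : ℝ} (ha : 1 < a) (hε : 0 < ε) :
    Integrable fun t : ℝ => (ε + |t|) ^ (-a) := by
  rw [funext (add_abs_rpow_eq (a := a) hε)]
  refine ((integrable_one_add_norm ?_).comp_div hε.ne').const_mul _
  simpa using ha

theorem integral_add_abs_rpow {a ε : ℝ} (hε : 0 < ε) :
    ∫ t : ℝ, (ε + |t|) ^ (-a) = ε ^ (-a + 1) * ∫ t : ℝ, (1 + ‖t‖) ^ (-a) := by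
  rw [funext (add_abs_rpow_eq (a := a) hε), integral_const_mul,
    Measure.integral_comp_div (fun t : ℝ => (1 + ‖t‖) ^ (-a)), abs_of_pos hε,
    Real.rpow_add_one hε.ne', smul_eq_mul, mul_assoc]

theorem one_sub_sq_rpow_le {γ s : ℝ} (hs0 : 0 ≤ s) (hs1 : s < 1) :
    (1 - s ^ 2) ^ γ ≤ 2 ^ |γ| * (1 - s) ^ γ := by
  rw [show 1 - s ^ 2 = (1 + s) * (1 - s) by ring,
    Real.mul_rpow (by linarith) (by linarith)]
  refine mul_le_mul_of_nonneg_right ?_ (Real.rpow_nonneg (by linarith) _)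
  exact (Real.rpow_le_rpow_of_exponent_le (by linarith) (le_abs_self γ)).trans
    (Real.rpow_le_rpow (by linarith) (by linarith) (abs_nonneg γ))

/-- A bound for an integral over the disc whose integrand has, after a rotation, a product
majorant in polar coordinates. -/
theorem setIntegral_ball_le_of_polar {f : ℂ → ℝ} {h₁ h₂ : ℝ → ℝ} (c : Circle)
    (hf : ∀ w ∈ ball (0 : ℂ) 1, 0 ≤ f w) (h₁i : Integrable h₁) (h₂i : Integrable h₂)
    (h₁0 : ∀ s, 0 ≤ h₁ s) (h₂0 : ∀ θ, 0 ≤ h₂ θ)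
    (h : ∀ s θ : ℝ, 0 < s → s < 1 → |θ| ≤ Real.pi →
      f (c * (s * (Real.cos θ + Real.sin θ * Complex.I))) ≤ h₁ s * h₂ θ) :
    ∫ w in ball (0 : ℂ) 1, f w ≤ (∫ s, h₁ s) * ∫ θ, h₂ θ := by
  have hind : ∀ w, 0 ≤ (ball (0 : ℂ) 1).indicator f w := indicator_nonneg hf
  rw [← integral_indicator measurableSet_ball,
    ← (rotation c).measurePreserving.integral_comp
      (rotation c).toHomeomorph.measurableEmbedding,
    ← Complex.integral_comp_polarCoord_symm, ← integral_prod_mul]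
  have hprod := h₁i.mul_prod h₂i
  refine (integral_mono_of_nonneg ?_ hprod.integrableOn ?_).trans
    (setIntegral_le_integral hprod (ae_of_all _ fun p => mul_nonneg (h₁0 _) (h₂0 _)))
  · refine ae_restrict_of_forall_mem polarCoord.open_target.measurableSet fun p hp => ?_
    rw [polarCoord_target] at hp
    exact smul_nonneg (le_of_lt hp.1) (hind _)
  · refine ae_restrict_of_forall_mem polarCoord.open_target.measurableSet fun p hp => ?_
    rw [polarCoord_target] at hp
    have hp1 : 0 < p.1 := hp.1
    have hp2 : |p.2| ≤ Real.pi := abs_le.2 ⟨hp.2.1.le, hp.2.2.le⟩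
    simp only [smul_eq_mul]
    by_cases hs : p.1 < 1
    · refine (mul_le_of_le_one_left (hind _) hs.le).trans ?_
      rw [indicator_of_mem, rotation_apply, Complex.polarCoord_symm_apply]
      · exact h _ _ hp1 hs hp2
      · rw [mem_ball_zero_iff, LinearIsometryEquiv.norm_map, Complex.norm_polarCoord_symm,
          abs_of_pos hp1]
        exact hs
    · rw [indicator_of_notMem, mul_zero]
      · exact mul_nonneg (h₁0 _) (h₂0 _)
      · rw [mem_ball_zero_iff, LinearIsometryEquiv.norm_map, Complex.norm_polarCoord_symm,
          abs_of_pos hp1]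
        exact hs

theorem exists_circle_mul_norm_eq (z : ℂ) : ∃ c : Circle, z = c * ‖z‖ := by
  refine ⟨Circle.exp z.arg, ?_⟩
  rw [Circle.coe_exp, mul_comm, Complex.norm_mul_exp_arg_mul_I]

/-- Proposition 4.1, part (4): for `q ∈ (1, ∞)` and `γ ∈ (-1, q]`,
`‖(k_z^B)''‖_{A^q(γ)} ≤ C (n/(1-r))^{3-(γ+2)/q}`,
where `r = max_i |λ_i|` and `|z| ≤ 1`. -/
theorem kernel_second_deriv_Bergman_estimate (q γ : ℝ) (hq : 1 < q)
    (hγ1 : -1 < γ) (hγ2 : γ ≤ q) :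
    ∃ C : ℝ, 0 < C ∧
      ∀ (n : ℕ), 1 ≤ n → ∀ σ : Fin n → ℂ,
      ∀ r : ℝ, (∀ i, ‖σ i‖ ≤ r) → r < 1 →
      ∀ z : ℂ, ‖z‖ ≤ 1 →
        bergmanNorm q γ (iteratedDeriv 2 (modelKernel σ z))
          ≤ C * ((n : ℝ) / (1 - r)) ^ (3 - (γ + 2) / q) := by
  obtain ⟨A, hA, hpt⟩ := exists_pointwise_bound
  set I₁ : ℝ := ∫ t, radialMajorant (2 * q) γ 1 t
  set I₂ : ℝ := ∫ t : ℝ, (1 + ‖t‖) ^ (-q)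
  have hI₁ : 0 ≤ I₁ := integral_nonneg fun t => radialMajorant_nonneg one_pos t
  have hI₂ : 0 ≤ I₂ := integral_nonneg fun t => by positivity
  set K : ℝ := Real.pi⁻¹ * ((4 * A) ^ q * 2 ^ |γ| * I₁ * I₂) with hK
  have hK0 : 0 ≤ K := by positivity
  refine ⟨K ^ (1 / q) + 1, by positivity, fun n hn σ r hr hr1 z hz => ?_⟩
  have hn' : (1 : ℝ) ≤ n := by exact_mod_cast hn
  set ε := (1 - r) / n with hε
  have hε0 : 0 < ε := div_pos (by linarith) (by linarith)
  have hεN : (n : ℝ) / (1 - r) = ε⁻¹ := by rw [hε, inv_div]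
  obtain ⟨c, hc⟩ := exists_circle_mul_norm_eq z
  have hmain : ∫ w in ball (0 : ℂ) 1,
      ‖iteratedDeriv 2 (modelKernel σ z) w‖ ^ q * (1 - ‖w‖ ^ 2) ^ γ ≤
      (∫ s, (4 * A) ^ q * 2 ^ |γ| * radialMajorant (2 * q) γ ε (1 - s)) *
        ∫ θ : ℝ, (ε + |θ|) ^ (-q) := by
    refine setIntegral_ball_le_of_polar c (fun w hw => ?_)
      (((integrable_radialMajorant hγ1 (by linarith) hε0).comp_sub_left 1).const_mul _)
      (integrable_add_abs_rpow hq hε0)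
      (fun s => mul_nonneg (by positivity) (radialMajorant_nonneg hε0 _))
      (fun θ => by positivity) ?_
    · have : ‖w‖ < 1 := by simpa using hw
      exact mul_nonneg (by positivity) (Real.rpow_nonneg (by nlinarith [norm_nonneg w]) _)
    · intro s θ hs0 hs1 hθ
      set e : ℂ := Real.cos θ + Real.sin θ * Complex.I with he
      have hnorm : ‖(c : ℂ) * (s * e)‖ = s := by
        have : ‖e‖ = 1 := by
          rw [he, Complex.ofReal_cos, Complex.ofReal_sin, Complex.norm_cos_add_sin_mul_I]
        rw [norm_mul, norm_mul, this, Circle.norm_coe, Complex.norm_real,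
          Real.norm_of_nonneg hs0.le]
        ring
      have hb := hpt n hn σ r hr hr1 z hz ((c : ℂ) * (s * e)) (by rw [hnorm]; exact hs1)
      have hrot : (starRingEnd ℂ) z * ((c : ℂ) * (s * e)) = ((‖z‖ * s : ℝ) : ℂ) * e := by
        have h1 : (starRingEnd ℂ) (c : ℂ) * c = 1 := by
          rw [Complex.conj_mul', Circle.norm_coe]; simp
        conv_lhs => rw [hc]
        rw [map_mul, Complex.conj_ofReal]
        push_cast
        linear_combination (‖z‖ : ℂ) * s * e * h1
      have hd := abs_le_four_mul_norm_one_sub (ρ := ‖z‖ * s) (θ := θ) (by positivity) hθ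
      rw [hnorm, hrot] at hb
      rw [hnorm]
      have hδ : 0 < ε + (1 - s) := by linarith
      have hb' : ‖iteratedDeriv 2 (modelKernel σ z) (c * (s * e))‖ ≤
          4 * A / ((ε + (1 - s)) ^ 2 * (ε + |θ|)) := by
        refine hb.trans ?_
        rw [← he] at hd
        rw [div_le_div_iff₀ (by positivity) (by positivity)]
        have : ε + |θ| ≤ 4 * (ε + ‖1 - ((‖z‖ * s : ℝ) : ℂ) * e‖) := by linarith
        calc A * ((ε + (1 - s)) ^ 2 * (ε + |θ|))
            ≤ A * ((ε + (1 - s)) ^ 2 * (4 * (ε + ‖1 - ((‖z‖ * s : ℝ) : ℂ) * e‖))) := by gcongr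
          _ = _ := by ring
      have hpow : ‖iteratedDeriv 2 (modelKernel σ z) (c * (s * e))‖ ^ q ≤
          (4 * A) ^ q * (ε + (1 - s)) ^ (-(2 * q)) * (ε + |θ|) ^ (-q) := by
        refine (Real.rpow_le_rpow (norm_nonneg _) hb' (by linarith)).trans (le_of_eq ?_)
        rw [Real.div_rpow (by positivity) (by positivity),
          Real.mul_rpow (x := (ε + (1 - s)) ^ 2) (by positivity) (by positivity),
          Real.rpow_neg hδ.le, Real.rpow_neg (by positivity), Real.rpow_mul hδ.le, Real.rpow_two]
        field_simp
      have hR : radialMajorant (2 * q) γ ε (1 - s) =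
          (ε + (1 - s)) ^ (-(2 * q)) * (1 - s) ^ γ :=
        indicator_of_mem (mem_Ioi.2 (by linarith)) _
      rw [hR]
      calc _ ≤ (4 * A) ^ q * (ε + (1 - s)) ^ (-(2 * q)) * (ε + |θ|) ^ (-q) *
            (2 ^ |γ| * (1 - s) ^ γ) :=
            mul_le_mul hpow (one_sub_sq_rpow_le hs0.le hs1)
              (Real.rpow_nonneg (by nlinarith) _) (by positivity)
        _ = _ := by ring
  rw [integral_const_mul, integral_sub_left_eq_self (radialMajorant (2 * q) γ ε),
    integral_radialMajorant hε0, integral_add_abs_rpow hε0] at hmain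
  have hexp : ε ^ (γ - 2 * q + 1) * ε ^ (-q + 1) = ε ^ (γ + 2 - 3 * q) := by
    rw [← Real.rpow_add hε0]
    congr 1
    ring
  have hbound : Real.pi⁻¹ * ∫ w in ball (0 : ℂ) 1,
      ‖iteratedDeriv 2 (modelKernel σ z) w‖ ^ q * (1 - ‖w‖ ^ 2) ^ γ ≤
      K * ε ^ (γ + 2 - 3 * q) := by
    rw [← hexp, hK]
    refine (mul_le_mul_of_nonneg_left hmain (by positivity)).trans (le_of_eq ?_)
    ring
  have hnonneg : 0 ≤ Real.pi⁻¹ * ∫ w in ball (0 : ℂ) 1,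
      ‖iteratedDeriv 2 (modelKernel σ z) w‖ ^ q * (1 - ‖w‖ ^ 2) ^ γ := by
    refine mul_nonneg (by positivity) (setIntegral_nonneg measurableSet_ball fun w hw => ?_)
    have : ‖w‖ < 1 := by simpa using hw
    exact mul_nonneg (by positivity) (Real.rpow_nonneg (by nlinarith [norm_nonneg w]) _)
  rw [bergmanNorm]
  calc _ ≤ (K * ε ^ (γ + 2 - 3 * q)) ^ (1 / q) := by gcongr
    _ = K ^ (1 / q) * ((n : ℝ) / (1 - r)) ^ (3 - (γ + 2) / q) := by
      rw [Real.mul_rpow hK0 (by positivity), ← Real.rpow_mul hε0.le, hεN, Real.inv_rpow hε0.le,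
        ← Real.rpow_neg hε0.le]
      congr 2
      field_simp
      ring
    _ ≤ _ := by
      gcongr
      linarith
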